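/- Let $r \ge 1$, let $\omega_1, \ldots, \omega_r > 0$ be positive reals, and let $x_1, \ldots, x_r \ge 0$. The Barnes multiple zeta function $\zeta_r(s, \omega, x) = \sum_{m_1,\ldots,m_r \ge 0}(x + m_1\omega_1 + \cdots + m_r\omega_r)^{-s}$ (with $x = \sum_k \omega_k x_k > 0$) extends meromorphically to $\mathbb{C}$, is holomorphic at $s = 0$, and satisfies $\zeta_r(0, \omega, \sum_{k=1}^r \omega_k x_k) = (-1)^r \sum_{\substack{(l_1,\ldots,l_r) \in \mathbb{Z}_{\ge 0}^r \\ l_1+\cdots+l_r = r}} \omega_1^{l_1-1}\cdots\omega_r^{l_r-1}\prod_{k=1}^r \frac{B_{l_k}(x_k)}{l_k!}$, where $B_n(x)$ is the $n$-th Bernoulli polynomial. -/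

import Mathlib

open Filter Topology Asymptotics Set MeasureTheory

/-- `f t` has the asymptotic expansion `∑ pₙ tⁿ` to all orders as `t → 0⁺`. -/
def HasTaylorAtZero (f : ℝ → ℂ) (p : PowerSeries ℂ) : Prop :=
  ∀ N : ℕ, (fun t : ℝ => f t - (p.trunc N).eval (t : ℂ)) =O[𝓝[>] 0] fun t : ℝ => t ^ N

theorem isBigO_one_eval_zero (q : Polynomial ℂ) :
    (fun t : ℝ => q.eval (t : ℂ)) =O[𝓝[>] 0] fun _ : ℝ => (1 : ℝ) := by
  have h : Continuous fun t : ℝ => q.eval (t : ℂ) := by fun_prop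
  exact ((h.tendsto 0).mono_left nhdsWithin_le_nhds).isBigO_one ℝ

theorem isBigO_pow_eval_zero {q : Polynomial ℂ} {N : ℕ} (h : q.toPowerSeries.trunc N = 0) :
    (fun t : ℝ => q.eval (t : ℂ)) =O[𝓝[>] 0] fun t : ℝ => t ^ N := by
  have hd : Polynomial.X ^ N ∣ q := by
    refine Polynomial.X_pow_dvd_iff.2 fun d hd => ?_
    have := congrArg (fun p => Polynomial.coeff p d) h
    simpa [PowerSeries.coeff_trunc, hd] using this
  obtain ⟨u, rfl⟩ := hd
  have h1 : (fun t : ℝ => (t : ℂ) ^ N) =O[𝓝[>] 0] fun t : ℝ => t ^ N :=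
    IsBigO.of_bound 1 (Eventually.of_forall fun t => by simp)
  simpa using h1.mul (isBigO_one_eval_zero u)

namespace HasTaylorAtZero

variable {f g h : ℝ → ℂ} {p q a b : PowerSeries ℂ}

theorem isBigO_one (hf : HasTaylorAtZero f p) : f =O[𝓝[>] 0] fun _ : ℝ => (1 : ℝ) := by
  simpa using hf 0

theorem sub_eval (hf : HasTaylorAtZero f p) {N : ℕ} {q : Polynomial ℂ}
    (hq : q.toPowerSeries.trunc N = p.trunc N) :
    (fun t : ℝ => f t - q.eval (t : ℂ)) =O[𝓝[>] 0] fun t : ℝ => t ^ N := by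
  have h0 : (p.trunc N - q).toPowerSeries.trunc N = 0 := by
    rw [Polynomial.coe_sub, map_sub, PowerSeries.trunc_trunc, hq, sub_self]
  refine ((hf N).add (isBigO_pow_eval_zero h0)).congr_left fun t => ?_
  simp

theorem of_polynomial (q : Polynomial ℂ) :
    HasTaylorAtZero (fun t => q.eval (t : ℂ)) q := fun N => by
  have h0 : (q - q.toPowerSeries.trunc N).toPowerSeries.trunc N = 0 := by
    rw [Polynomial.coe_sub, map_sub, PowerSeries.trunc_trunc, sub_self]
  simpa using isBigO_pow_eval_zero h0

theorem sub (hf : HasTaylorAtZero f p) (hg : HasTaylorAtZero g q) :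
    HasTaylorAtZero (fun t => f t - g t) (p - q) := fun N => by
  refine ((hf N).sub (hg N)).congr_left fun t => ?_
  rw [map_sub, Polynomial.eval_sub]
  ring

theorem mul (hf : HasTaylorAtZero f p) (hg : HasTaylorAtZero g q) :
    HasTaylorAtZero (fun t => f t * g t) (p * q) := fun N => by
  have h1 := (hf N).mul hg.isBigO_one
  have h2 := (isBigO_one_eval_zero (p.trunc N)).mul (hg N)
  have h0 : (p.trunc N * q.trunc N - (p * q).trunc N).toPowerSeries.trunc N = 0 := by
    rw [Polynomial.coe_sub, map_sub, PowerSeries.trunc_trunc, Polynomial.coe_mul,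
      PowerSeries.trunc_trunc_mul_trunc, sub_self]
  have h3 := isBigO_pow_eval_zero h0
  simp only [mul_one, one_mul] at h1 h2
  refine ((h1.add h2).add h3).congr_left fun t => ?_
  simp only [Polynomial.eval_sub, Polynomial.eval_mul]
  ring

theorem prod {ι : Type*} (s : Finset ι) {f : ι → ℝ → ℂ} {p : ι → PowerSeries ℂ}
    (hf : ∀ i ∈ s, HasTaylorAtZero (f i) (p i)) :
    HasTaylorAtZero (fun t => ∏ i ∈ s, f i t) (∏ i ∈ s, p i) := by
  classical
  induction s using Finset.induction_on with
  | empty => simpa using of_polynomial 1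
  | insert i s hi ih =>
    simp only [Finset.prod_insert hi]
    exact (hf i (Finset.mem_insert_self i s)).mul
      (ih fun j hj => hf j (Finset.mem_insert_of_mem hj))

theorem exp (a : ℂ) : HasTaylorAtZero (fun t => Complex.exp (a * t))
    (PowerSeries.rescale a (PowerSeries.exp ℂ)) := fun N => by
  have hb : (fun t : ℝ => Real.exp ‖a * t‖) =O[𝓝[>] 0] fun _ : ℝ => (1 : ℝ) := by
    have h : Continuous fun t : ℝ => Real.exp ‖a * t‖ := by fun_prop
    exact ((h.tendsto 0).mono_left nhdsWithin_le_nhds).isBigO_one ℝ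
  have hp : (fun t : ℝ => ‖a * t‖ ^ N) =O[𝓝[>] 0] fun t : ℝ => t ^ N :=
    IsBigO.of_bound (‖a‖ ^ N) (Eventually.of_forall fun t => by simp [mul_pow])
  have hpb := hp.mul hb
  simp only [mul_one] at hpb
  refine IsBigO.trans (IsBigO.of_bound 1 (Eventually.of_forall fun t => ?_)) hpb
  have h := Complex.norm_exp_sub_sum_le_norm_mul_exp (a * t) N
  rw [one_mul, Real.norm_of_nonneg (by positivity)]
  convert h using 3
  rw [Polynomial.eval, PowerSeries.eval₂_trunc_eq_sum_range]
  refine Finset.sum_congr rfl fun i _ => ?_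
  simp [PowerSeries.coeff_exp]
  ring

/-- Division of asymptotic expansions by a function with at most a simple zero. -/
theorem of_mul (hf : HasTaylorAtZero f a) (hh : HasTaylorAtZero h b)
    (hmul : ∀ᶠ t in 𝓝[>] (0 : ℝ), g t * h t = f t) (hpb : p * b = a)
    (hsimple : (fun t : ℝ => t) =O[𝓝[>] 0] h) : HasTaylorAtZero g p := fun N => by
  set P := p.trunc (N + 1)
  have h1 : (fun t : ℝ => (f t - P.eval (t : ℂ) * h t)) =O[𝓝[>] 0] fun t : ℝ => t ^ (N + 1) := by
    have := (hf.sub ((of_polynomial P).mul hh)) (N + 1)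
    refine this.congr_left fun t => ?_
    rw [map_sub, PowerSeries.trunc_trunc_mul, hpb]
    simp
  have h2 : (fun t : ℝ => (g t - P.eval (t : ℂ)) * t) =O[𝓝[>] 0] fun t : ℝ => t ^ (N + 1) := by
    have h3 : (fun t : ℝ => (t : ℂ)) =O[𝓝[>] 0] h :=
      (IsBigO.of_bound 1 (Eventually.of_forall fun t => by simp)).trans hsimple
    refine (((isBigO_refl _ _).mul h3).congr' EventuallyEq.rfl ?_).trans h1
    filter_upwards [hmul] with t ht
    rw [← ht]
    ring
  have h4 : (fun t : ℝ => g t - P.eval (t : ℂ)) =O[𝓝[>] 0] fun t : ℝ => t ^ N := by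
    have hinv : (fun t : ℝ => (t : ℂ)⁻¹) =O[𝓝[>] 0] fun t : ℝ => t⁻¹ :=
      IsBigO.of_bound 1 (Eventually.of_forall fun t => by simp)
    refine (h2.mul hinv).congr' ?_ ?_
    · filter_upwards [self_mem_nhdsWithin] with t ht
      have : (t : ℂ) ≠ 0 := by exact_mod_cast ne_of_gt ht
      field_simp
    · filter_upwards [self_mem_nhdsWithin] with t ht
      have : t ≠ 0 := ne_of_gt ht
      field_simp
      ring
  have h0 : (P - p.trunc N).toPowerSeries.trunc N = 0 := by
    rw [Polynomial.coe_sub, map_sub, PowerSeries.trunc_trunc,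
      PowerSeries.trunc_trunc_of_le _ N.le_succ, sub_self]
  refine (h4.add (isBigO_pow_eval_zero h0)).congr_left fun t => ?_
  simp

end HasTaylorAtZero

theorem hasSum_mul_of_summable_norm {α β : Type*} {u : α → ℂ} {v : β → ℂ} {b : ℂ}
    (hu : Summable fun i => ‖u i‖) (hv : Summable fun j => ‖v j‖) (hb : HasSum v b) :
    Summable (fun q : α × β => ‖u q.1 * v q.2‖) ∧
      HasSum (fun q : α × β => u q.1 * v q.2) ((∑' i, u i) * b) :=
  ⟨hu.mul_norm hv, hu.of_norm.hasSum.mul hb (hu.mul_norm hv).of_norm⟩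

theorem hasSum_prod_fin {r : ℕ} {f : Fin r → ℕ → ℂ} (hf : ∀ k, Summable fun n => ‖f k n‖) :
    Summable (fun m : Fin r → ℕ => ‖∏ k, f k (m k)‖) ∧
      HasSum (fun m : Fin r → ℕ => ∏ k, f k (m k)) (∏ k, ∑' n, f k n) := by
  induction r with
  | zero => exact ⟨(hasSum_unique _).summable, by simp⟩
  | succ r ih =>
    obtain ⟨h1, h2⟩ := ih (f := fun k => f k.succ) fun k => hf k.succ
    obtain ⟨hs, hh⟩ := hasSum_mul_of_summable_norm (hf 0) h1 h2
    have he : ∀ q : ℕ × (Fin r → ℕ), ∏ k, f k (Fin.consEquiv (fun _ => ℕ) q k) =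
        f 0 q.1 * ∏ k, f k.succ (q.2 k) := fun q => by
      rw [Fin.prod_univ_succ]
      rfl
    rw [Fin.prod_univ_succ, ← (Fin.consEquiv fun _ => ℕ).hasSum_iff,
      ← (Fin.consEquiv fun _ => ℕ).summable_iff]
    simp only [Function.comp_def, he]
    exact ⟨hs, hh⟩

theorem summable_linear_form_rpow {r : ℕ} (hr : 1 ≤ r) {ω : Fin r → ℝ} (hω : ∀ k, 0 < ω k) {X : ℝ}
    (hX : 0 < X) {σ : ℝ} (hσ : r < σ) :
    Summable fun m : Fin r → ℕ => (X + ∑ j, (m j : ℝ) * ω j) ^ (-σ) := by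
  have hr0 : (0 : ℝ) < r := by exact_mod_cast hr
  have hσr : 1 < σ / r := by rwa [one_lt_div hr0]
  set c : Fin r → ℝ := fun k => min X (ω k)
  have hc : ∀ k, 0 < c k := fun k => lt_min hX (hω k)
  have hsum : ∀ k, Summable fun n : ℕ => ‖(((c k * (n + 1)) ^ (-(σ / r)) : ℝ) : ℂ)‖ := fun k => by
    have h1 : Summable fun n : ℕ => ((n + 1 : ℕ) : ℝ) ^ (-(σ / r)) :=
      (summable_nat_add_iff 1).2 (Real.summable_nat_rpow.2 (by linarith))
    refine (h1.mul_left (c k ^ (-(σ / r)))).congr fun n => ?_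
    have h0 : (0 : ℝ) < n + 1 := by positivity
    rw [Complex.norm_real, Real.norm_of_nonneg (Real.rpow_nonneg (mul_pos (hc k) h0).le _),
      Real.mul_rpow (hc k).le h0.le, Nat.cast_succ]
  refine (hasSum_prod_fin hsum).1.of_nonneg_of_le (fun m => ?_) fun m => ?_
  · exact Real.rpow_nonneg (add_nonneg hX.le
      (Finset.sum_nonneg fun j _ => mul_nonneg (Nat.cast_nonneg _) (hω j).le)) _
  · have hle : ∀ k, c k * (m k + 1) ≤ X + ∑ j, (m j : ℝ) * ω j := fun k => by
      have h1 : (m k : ℝ) * ω k ≤ ∑ j, (m j : ℝ) * ω j :=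
        Finset.single_le_sum (f := fun j => (m j : ℝ) * ω j)
          (fun j _ => mul_nonneg (Nat.cast_nonneg _) (hω j).le) (Finset.mem_univ k)
      have h2 : c k ≤ X := min_le_left _ _
      have h3 : c k * m k ≤ ω k * m k :=
        mul_le_mul_of_nonneg_right (min_le_right _ _) (Nat.cast_nonneg _)
      linarith
    have hpos : ∀ k, 0 < c k * (m k + 1) := fun k => mul_pos (hc k) (by positivity)
    have hS : 0 < X + ∑ j, (m j : ℝ) * ω j := (hpos ⟨0, hr⟩).trans_le (hle _)
    have h1 : (X + ∑ j, (m j : ℝ) * ω j) ^ (-σ) =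
        ∏ _k : Fin r, (X + ∑ j, (m j : ℝ) * ω j) ^ (-(σ / r)) := by
      rw [Finset.prod_const, Finset.card_univ, Fintype.card_fin, ← Real.rpow_mul_natCast hS.le]
      congr 1
      field_simp
    rw [norm_prod, h1]
    refine Finset.prod_le_prod (fun k _ => (Real.rpow_nonneg hS.le _)) fun k _ => ?_
    rw [Complex.norm_real, Real.norm_of_nonneg (Real.rpow_nonneg (hpos k).le _)]
    exact Real.rpow_le_rpow_of_nonpos (hpos k) (hle k) (by linarith)

theorem Complex.Gamma_inv_div_sub_extension (r n : ℕ) : ∃ q : ℂ → ℂ,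
    (∀ s, s ≠ (r : ℂ) - n → q s = (Complex.Gamma s)⁻¹ / (s - (r - n))) ∧
    (∀ s : ℂ, (∀ t : ℕ, 1 ≤ t → t ≤ r → s ≠ (t : ℂ)) → DifferentiableAt ℂ q s) ∧
    q 0 = if n = r then 1 else 0 := by
  have hG := Complex.differentiable_one_div_Gamma
  rcases lt_or_ge n r with hn | hn
  · refine ⟨fun s => (Complex.Gamma s)⁻¹ / (s - (r - n)), fun s _ => rfl, fun s hs => ?_, ?_⟩
    · have h := hs (r - n) (by omega) (by omega)
      rw [Nat.cast_sub hn.le] at h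
      exact (hG s).div (by fun_prop) (sub_ne_zero.2 h)
    · simp [hn.ne]
  · have h0 : (Complex.Gamma ((r : ℂ) - n))⁻¹ = 0 := by
      have := Complex.Gamma_neg_nat_eq_zero (n - r)
      rw [Nat.cast_sub hn, neg_sub] at this
      rw [this, inv_zero]
    refine ⟨dslope (fun s => (Complex.Gamma s)⁻¹) ((r : ℂ) - n), fun s hs => ?_, fun s _ => ?_, ?_⟩
    · rw [dslope_of_ne _ hs, slope_def_field, h0, sub_zero]
    · exact ((Complex.differentiableOn_dslope univ_mem).2 hG.differentiableOn).differentiableAt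
        univ_mem
    · rcases eq_or_ne n r with rfl | hne
      · rw [sub_self, dslope_same, if_pos rfl,
          funext Complex.one_div_Gamma_eq_self_mul_one_div_Gamma_add_one]
        have h1 : HasDerivAt (fun s : ℂ => (Complex.Gamma (s + 1))⁻¹) _ 0 :=
          (hG.comp (differentiable_id.add_const 1) 0).hasDerivAt
        refine ((hasDerivAt_id' (0 : ℂ)).fun_mul h1).deriv.trans ?_
        simp
      · have : (0 : ℂ) ≠ (r : ℂ) - n := by
          rw [ne_comm, sub_ne_zero]
          exact_mod_cast hne.symm
        rw [dslope_of_ne _ this, slope_def_field, h0]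
        simp [hne]

/-- If `F` decays rapidly at infinity and has an asymptotic expansion `∑ cₙ t ^ (n - r)` at `0⁺`,
then `mellin F s / Γ(s)` continues analytically to `ℂ ∖ {1, …, r}`, with value `c_r` at `0`. -/
theorem exists_analytic_mellin_div_Gamma {F : ℝ → ℂ} {r : ℕ} {c : ℕ → ℂ}
    (hF : LocallyIntegrableOn F (Ioi 0)) (hinf : ∀ a : ℝ, F =O[atTop] fun t : ℝ => t ^ (-a))
    (hzero : ∀ N : ℕ, (fun t : ℝ => F t - ∑ n ∈ Finset.range N, c n * (t : ℂ) ^ ((n : ℂ) - r))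
      =O[𝓝[>] 0] fun t : ℝ => t ^ (-((r : ℝ) - N))) :
    ∃ Z : ℂ → ℂ, (∀ s : ℂ, (r : ℝ) < s.re → Z s = (Complex.Gamma s)⁻¹ * mellin F s) ∧
      (∀ s : ℂ, (∀ t : ℕ, 1 ≤ t → t ≤ r → s ≠ (t : ℂ)) → AnalyticAt ℂ Z s) ∧ Z 0 = c r := by
  choose q hq hqd hq0 using Complex.Gamma_inv_div_sub_extension r
  set e : ℕ → ℝ → ℂ := fun n => indicator (Ioc 0 1) fun t : ℝ => (t : ℂ) ^ ((n : ℂ) - r) with he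
  set f : ℕ → ℝ → ℂ := fun N t => F t - ∑ n ∈ Finset.range N, c n * e n t with hf
  have he_int : ∀ n, LocallyIntegrableOn (e n) (Ioi 0) := fun n => by
    have h1 : ContinuousOn (fun t : ℝ => (t : ℂ) ^ ((n : ℂ) - r)) (Ioi 0) := fun t ht =>
      (Complex.continuousAt_ofReal_cpow_const t _ (Or.inr (ne_of_gt ht))).continuousWithinAt
    intro t ht
    obtain ⟨u, hu, hu'⟩ := h1.locallyIntegrableOn (μ := volume) measurableSet_Ioi t ht
    exact ⟨u, hu, hu'.indicator measurableSet_Ioc⟩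
  have hf_int : ∀ N, LocallyIntegrableOn (f N) (Ioi 0) := fun N => by
    induction N with
    | zero => simpa [hf] using hF
    | succ N ih =>
      have : f (N + 1) = fun t => f N t - c N • e N t := by
        ext t
        simp only [hf, Finset.sum_range_succ, smul_eq_mul]
        ring
      rw [this]
      exact ih.sub ((he_int N).smul (c N))
  have hf_inf : ∀ N, ∀ a : ℝ, f N =O[atTop] fun t : ℝ => t ^ (-a) := fun N a => by
    refine (hinf a).congr' ?_ EventuallyEq.rfl
    filter_upwards [eventually_gt_atTop 1] with t ht
    simp [hf, he, ht]
  have hf_zero : ∀ N : ℕ, f N =O[𝓝[>] 0] fun t : ℝ => t ^ (-((r : ℝ) - N)) := fun N => by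
    refine (hzero N).congr' ?_ EventuallyEq.rfl
    filter_upwards [Ioc_mem_nhdsGT zero_lt_one] with t ht
    simp [hf, he, ht.1, ht.2]
  set A : ℕ → ℂ → ℂ := fun N s => (Complex.Gamma s)⁻¹ * mellin (f N) s +
    ∑ n ∈ Finset.range N, c n * q n s with hA
  have hA_diff : ∀ (N : ℕ) (s : ℂ), (r : ℝ) - N < s.re →
      (∀ t : ℕ, 1 ≤ t → t ≤ r → s ≠ (t : ℂ)) → DifferentiableAt ℂ (A N) s := fun N s hs hst => by
    have hm := mellin_differentiableAt_of_isBigO_rpow (hf_int N) (hf_inf N (s.re + 1))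
      (lt_add_one _) (hf_zero N) hs
    exact ((Complex.differentiable_one_div_Gamma s).mul hm).add
      (DifferentiableAt.fun_sum fun n _ => (hqd n s hst).const_mul _)
  have hA_succ : ∀ (N : ℕ) (s : ℂ), (r : ℝ) - N < s.re → A N s = A (N + 1) s := fun N s hs => by
    have hm := mellinConvergent_of_isBigO_rpow (s := s) (hf_int N) (hf_inf N (s.re + 1))
      (lt_add_one _) (hf_zero N) hs
    have hme := hasMellin_cpow_Ioc ((N : ℂ) - r) (s := s) (by simp; linarith)
    have hme' := hasMellin_const_smul hme.1 (c N)
    have hne : s ≠ (r : ℂ) - N := fun h => by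
      rw [h] at hs
      simp at hs
    have : f (N + 1) = fun t => f N t - c N • e N t := by
      ext t
      simp only [hf, Finset.sum_range_succ, smul_eq_mul]
      ring
    have hM : mellin (f (N + 1)) s = mellin (f N) s - c N * (1 / (s + ((N : ℂ) - r))) := by
      rw [this, (hasMellin_sub hm hme'.1).2, hme'.2, hme.2, smul_eq_mul]
    simp only [hA]
    rw [Finset.sum_range_succ, hM, hq N s hne, show s + ((N : ℂ) - r) = s - (r - N) by ring]
    ring
  have hA_le : ∀ (N M : ℕ) (s : ℂ), (r : ℝ) - N < s.re → N ≤ M → A N s = A M s :=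
    fun N M s hs hNM => by
    induction M, hNM using Nat.le_induction with
    | base => rfl
    | succ M hM ih =>
      have : (N : ℝ) ≤ M := by exact_mod_cast hM
      rw [ih, hA_succ M s (by linarith)]
  have hex : ∀ s : ℂ, ∃ N : ℕ, (r : ℝ) - N < s.re := fun s => by
    obtain ⟨N, hN⟩ := exists_nat_gt ((r : ℝ) - s.re)
    exact ⟨N, by linarith⟩
  choose ν hν using hex
  have hZ : ∀ (N : ℕ) (s : ℂ), (r : ℝ) - N < s.re → A (ν s) s = A N s := fun N s hs => by
    rcases le_total N (ν s) with h | h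
    · exact (hA_le N _ s hs h).symm
    · exact hA_le _ N s (hν s) h
  refine ⟨fun s => A (ν s) s, fun s hs => ?_, fun s hs => ?_, ?_⟩
  · change A (ν s) s = _
    rw [hZ 0 s (by simpa using hs)]
    simp [hA, hf]
  · have hopen : IsOpen {z : ℂ | (r : ℝ) - ν s < z.re} :=
      isOpen_lt continuous_const Complex.continuous_re
    have hfin : ∀ᶠ z in 𝓝 s, ∀ t ∈ Finset.Icc 1 r, z ≠ (t : ℂ) :=
      (Finset.eventually_all _).2 fun t ht => by
        rw [Finset.mem_Icc] at ht
        exact isOpen_ne.mem_nhds (hs t ht.1 ht.2)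
    have han : AnalyticAt ℂ (A (ν s)) s := by
      rw [Complex.analyticAt_iff_eventually_differentiableAt]
      filter_upwards [hopen.mem_nhds (hν s), hfin] with z hz hz'
      exact hA_diff _ z hz fun t h1 h2 => hz' t (Finset.mem_Icc.2 ⟨h1, h2⟩)
    refine han.congr ?_
    filter_upwards [hopen.mem_nhds (hν s)] with z hz
    exact (hZ _ z hz).symm
  · change A (ν 0) 0 = c r
    rw [hZ (r + 1) 0 (by simp)]
    simp [hA, hq0]

theorem isBigO_self_exp_sub_one {w : ℂ} (hw : w ≠ 0) :
    (fun t : ℝ => t) =O[𝓝[>] 0] fun t : ℝ => Complex.exp (w * t) - 1 := by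
  have hd : HasDerivAt (fun t : ℝ => Complex.exp (w * t)) w 0 := by
    have h1 : HasDerivAt (fun t : ℝ => w * (t : ℂ)) w 0 := by
      simpa using (hasDerivAt_id (0 : ℝ)).ofReal_comp.const_mul w
    simpa using h1.cexp
  have hl : Tendsto (fun t : ℝ => (t, (0 : ℝ))) (𝓝[>] 0) (𝓝 0 ×ˢ pure 0) :=
    (tendsto_id'.2 nhdsWithin_le_nhds).prodMk (tendsto_pure.2 (Eventually.of_forall fun _ => rfl))
  simpa [Function.comp_def] using (hd.isTheta_sub hw).isBigO_symm.comp_tendsto hl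

/-- The expansion at `0⁺` of one factor of the Barnes generating function. -/
theorem hasTaylorAtZero_bernoulli {w : ℝ} (hw : 0 < w) (x : ℝ) :
    HasTaylorAtZero
      (fun t => t * (Complex.exp (-(w * x) * t) * (1 - Complex.exp (-w * t))⁻¹))
      (PowerSeries.mk fun n => (-1) ^ n * (w : ℂ) ^ ((n : ℤ) - 1) *
        (((Polynomial.aeval x (Polynomial.bernoulli n) : ℝ) : ℂ) / (n.factorial : ℂ))) := by
  have hw0 : (w : ℂ) ≠ 0 := by exact_mod_cast hw.ne'
  have hX := HasTaylorAtZero.of_polynomial (-Polynomial.X)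
  have hone := HasTaylorAtZero.of_polynomial 1
  refine (hX.mul (HasTaylorAtZero.exp (-(w * x)))).of_mul
    ((HasTaylorAtZero.exp (-w)).sub hone) ?_ ?_ ?_
  · filter_upwards [self_mem_nhdsWithin] with t ht
    have hne : 1 - Complex.exp (-w * t) ≠ 0 := by
      rw [sub_ne_zero, ne_comm]
      have h : Real.exp (-w * t) ≠ 1 := by
        rw [Ne, Real.exp_eq_one_iff]
        exact mul_ne_zero (neg_ne_zero.2 hw.ne') (ne_of_gt ht)
      exact_mod_cast h
    simp only [Polynomial.eval_neg, Polynomial.eval_X, Polynomial.eval_one]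
    calc _ = -(t * Complex.exp (-(w * x) * t)) *
          ((1 - Complex.exp (-w * t))⁻¹ * (1 - Complex.exp (-w * t))) := by ring
      _ = _ := by rw [inv_mul_cancel₀ hne]; ring
  · have hgen := congrArg (PowerSeries.rescale (-w : ℂ))
      (Polynomial.bernoulli_generating_function (x : ℂ))
    rw [map_mul, map_mul, map_sub, map_one, PowerSeries.rescale_X,
      PowerSeries.rescale_rescale] at hgen
    have hp : (PowerSeries.mk fun n => (-1) ^ n * (w : ℂ) ^ ((n : ℤ) - 1) *
        (((Polynomial.aeval x (Polynomial.bernoulli n) : ℝ) : ℂ) / (n.factorial : ℂ))) =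
        PowerSeries.C (w : ℂ)⁻¹ * PowerSeries.rescale (-w : ℂ) (PowerSeries.mk fun n =>
          Polynomial.aeval (x : ℂ) ((1 / n.factorial : ℚ) • Polynomial.bernoulli n)) := by
      ext n
      have hB : Polynomial.aeval (x : ℂ) (Polynomial.bernoulli n) =
          ((Polynomial.aeval x (Polynomial.bernoulli n) : ℝ) : ℂ) :=
        Polynomial.aeval_algebraMap_apply ℂ x _
      rw [PowerSeries.coeff_C_mul, PowerSeries.coeff_rescale, PowerSeries.coeff_mk,
        PowerSeries.coeff_mk, map_smul, hB, zpow_sub₀ hw0, zpow_natCast, zpow_one, neg_pow (w : ℂ),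
        Algebra.smul_def]
      simp
      ring
    rw [hp, Polynomial.coe_one, mul_assoc, hgen, ← mul_assoc, ← mul_assoc, ← map_mul,
      mul_neg, inv_mul_cancel₀ hw0]
    simp [mul_comm]
  · simpa using isBigO_self_exp_sub_one (neg_ne_zero.2 hw0)

theorem norm_exp_neg_lt_one {w t : ℝ} (hw : 0 < w) (ht : 0 < t) :
    ‖Complex.exp (-w * t)‖ < 1 := by
  rw [Complex.norm_exp]
  simpa using mul_pos hw ht

/-- The function whose Mellin transform is `Γ(s) ζ_r(s, ω, ∑ ω_k x_k)`. -/
noncomputable def barnesKernel {r : ℕ} (ω x : Fin r → ℝ) (t : ℝ) : ℂ :=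
  ∏ k, (Complex.exp (-(ω k * x k) * t) * (1 - Complex.exp (-ω k * t))⁻¹)

section barnesKernel

variable {r : ℕ} {ω x : Fin r → ℝ}

theorem hasSum_barnesKernel (hω : ∀ k, 0 < ω k) {t : ℝ} (ht : 0 < t) :
    HasSum (fun m : Fin r → ℕ =>
      (1 : ℂ) * (Real.exp (-(∑ k, ω k * x k + ∑ j, (m j : ℝ) * ω j) * t) : ℂ))
      (barnesKernel ω x t) := by
  have hlt : ∀ k, ‖Complex.exp (-ω k * t)‖ < 1 := fun k => norm_exp_neg_lt_one (hω k) ht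
  have h := (hasSum_prod_fin (f := fun k n =>
    Complex.exp (-(ω k * x k) * t) * Complex.exp (-ω k * t) ^ n) fun k => by
      simp only [norm_mul, norm_pow]
      exact (summable_geometric_of_lt_one (norm_nonneg _) (hlt k)).mul_left _).2
  simp only [tsum_mul_left, tsum_geometric_of_norm_lt_one (hlt _)] at h
  have hterm : ∀ m : Fin r → ℕ,
      (1 : ℂ) * (Real.exp (-(∑ k, ω k * x k + ∑ j, (m j : ℝ) * ω j) * t) : ℂ) =
        ∏ k, Complex.exp (-(ω k * x k) * t) * Complex.exp (-ω k * t) ^ m k := fun m => by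
    rw [one_mul, Complex.ofReal_exp, Finset.prod_congr rfl fun k _ => by
      rw [← Complex.exp_nat_mul, ← Complex.exp_add], ← Complex.exp_sum]
    congr 1
    push_cast
    rw [← Finset.sum_add_distrib, ← Finset.sum_neg_distrib, Finset.sum_mul]
    exact Finset.sum_congr rfl fun k _ => by ring
  simp only [hterm]
  exact h

theorem continuousOn_barnesKernel (hω : ∀ k, 0 < ω k) :
    ContinuousOn (barnesKernel ω x) (Ioi 0) := by
  refine continuousOn_finsetProd _ fun k _ => ContinuousOn.mul (by fun_prop)
    (ContinuousOn.inv₀ (by fun_prop) fun t ht => ?_)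
  rw [sub_ne_zero]
  intro h
  simpa only [← h, norm_one, lt_irrefl] using norm_exp_neg_lt_one (hω k) ht

theorem barnesKernel_isBigO_atTop (hω : ∀ k, 0 < ω k) (hx : 0 < ∑ k, ω k * x k) (a : ℝ) :
    barnesKernel ω x =O[atTop] fun t : ℝ => t ^ (-a) := by
  have h1 : ∀ k, Tendsto (fun t : ℝ => (1 - Complex.exp (-ω k * t))⁻¹) atTop (𝓝 1) := fun k => by
    have h2 : Tendsto (fun t : ℝ => Complex.exp (-ω k * t)) atTop (𝓝 0) := by
      rw [tendsto_zero_iff_norm_tendsto_zero]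
      simp only [Complex.norm_exp]
      refine Real.tendsto_exp_atBot.comp ?_
      simpa using tendsto_id.const_mul_atTop (hω k)
    simpa using (h2.const_sub 1).inv₀ (by simp)
  have h3 : (fun t : ℝ => ∏ k, (1 - Complex.exp (-ω k * t))⁻¹) =O[atTop] fun _ => (1 : ℝ) :=
    (tendsto_finsetProd _ fun k _ => h1 k).isBigO_one ℝ
  have h4 : (fun t : ℝ => ∏ k, Complex.exp (-(ω k * x k) * t)) =O[atTop]
      fun t => Real.exp (-(∑ k, ω k * x k) * t) :=
    IsBigO.of_bound 1 (Eventually.of_forall fun t => by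
      rw [← Complex.exp_sum, Complex.norm_exp, one_mul, Real.norm_eq_abs, Real.abs_exp]
      simp [Finset.sum_mul])
  have h5 := (h4.mul h3).trans_isLittleO
    (g := fun t => Real.exp (-(∑ k, ω k * x k) * t) * 1) (k := fun t : ℝ => t ^ (-a))
    (by simpa using isLittleO_exp_neg_mul_rpow_atTop hx (-a))
  refine h5.isBigO.congr_left fun t => ?_
  rw [barnesKernel, Finset.prod_mul_distrib]

/-- The coefficients of the expansion of `t ^ r * barnesKernel ω x t` at `0⁺`. -/
noncomputable def barnesSeries (ω x : Fin r → ℝ) : PowerSeries ℂ :=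
  ∏ k, PowerSeries.mk fun n => (-1) ^ n * (ω k : ℂ) ^ ((n : ℤ) - 1) *
    (((Polynomial.aeval (x k) (Polynomial.bernoulli n) : ℝ) : ℂ) / (n.factorial : ℂ))

theorem coeff_barnesSeries (ω x : Fin r → ℝ) (n : ℕ) :
    (barnesSeries ω x).coeff n = (-1) ^ n * ∑ l ∈ Finset.Nat.antidiagonalTuple r n,
        (∏ k, ((ω k : ℂ) ^ ((l k : ℤ) - 1))) *
          ∏ k, (((Polynomial.aeval (x k) (Polynomial.bernoulli (l k)) : ℝ) : ℂ) /
            (Nat.factorial (l k) : ℂ)) := by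
  rw [barnesSeries, PowerSeries.coeff_prod, Finset.mul_sum]
  refine Finset.sum_bij (fun l _ => l) (fun l hl => ?_) (fun _ _ _ _ h => DFunLike.coe_injective h)
    (fun l hl => ⟨Finsupp.equivFunOnFinite.symm l, ?_, rfl⟩) fun l hl => ?_
  · rw [Finset.mem_finsuppAntidiag'] at hl
    rw [Finset.Nat.mem_antidiagonalTuple, ← hl.1, Finsupp.sum_fintype _ _ fun _ => rfl]
  · rw [Finset.Nat.mem_antidiagonalTuple] at hl
    rw [Finset.mem_finsuppAntidiag]
    simpa using hl
  · rw [Finset.mem_finsuppAntidiag] at hl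
    simp only [PowerSeries.coeff_mk, Finset.prod_mul_distrib, Finset.prod_pow_eq_pow_sum]
    rw [hl.1, mul_assoc]

theorem barnesKernel_sub_isBigO (hω : ∀ k, 0 < ω k) (N : ℕ) :
    (fun t : ℝ => barnesKernel ω x t -
      ∑ n ∈ Finset.range N, (barnesSeries ω x).coeff n * (t : ℂ) ^ ((n : ℂ) - r))
      =O[𝓝[>] 0] fun t : ℝ => t ^ (-((r : ℝ) - N)) := by
  have h := HasTaylorAtZero.prod Finset.univ
    (fun k _ => hasTaylorAtZero_bernoulli (hω k) (x k)) N
  have hinv : (fun t : ℝ => ((t : ℂ) ^ r)⁻¹) =O[𝓝[>] 0] fun t : ℝ => (t ^ r)⁻¹ :=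
    IsBigO.of_bound 1 (Eventually.of_forall fun t => by simp)
  refine (hinv.mul h).congr' ?_ ?_
  · filter_upwards [self_mem_nhdsWithin] with t ht
    have ht0 : (t : ℂ) ≠ 0 := by exact_mod_cast ne_of_gt ht
    rw [Polynomial.eval, PowerSeries.eval₂_trunc_eq_sum_range, mul_sub, Finset.mul_sum,
      Finset.prod_mul_distrib]
    congr 1
    · simp only [Finset.prod_const, Finset.card_univ, Fintype.card_fin]
      rw [inv_mul_cancel_left₀ (pow_ne_zero _ ht0), barnesKernel]
    · refine Finset.sum_congr rfl fun n _ => ?_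
      rw [Complex.cpow_sub _ _ ht0, Complex.cpow_natCast, Complex.cpow_natCast]
      simp only [RingHom.id_apply, barnesSeries]
      ring
  · filter_upwards [self_mem_nhdsWithin] with t ht
    rw [neg_sub, Real.rpow_sub ht, Real.rpow_natCast, Real.rpow_natCast]
    ring

theorem hasSum_barnes_mellin (hr : 1 ≤ r) (hω : ∀ k, 0 < ω k) (hx : 0 < ∑ k, ω k * x k) {s : ℂ}
    (hs : (r : ℝ) < s.re) :
    HasSum (fun m : Fin r → ℕ =>
      (((∑ k, ω k * x k) + ∑ j, (m j : ℝ) * ω j : ℝ) : ℂ) ^ (-s))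
      ((Complex.Gamma s)⁻¹ * mellin (barnesKernel ω x) s) := by
  have hs0 : 0 < s.re := (Nat.cast_nonneg r).trans_lt hs
  have hpos : ∀ m : Fin r → ℕ, 0 < ∑ k, ω k * x k + ∑ j, (m j : ℝ) * ω j := fun m =>
    add_pos_of_pos_of_nonneg hx
      (Finset.sum_nonneg fun j _ => mul_nonneg (Nat.cast_nonneg _) (hω j).le)
  have h := hasSum_mellin (fun m => Or.inr (hpos m)) hs0
    (fun t ht => hasSum_barnesKernel (x := x) hω ht)
    ((summable_linear_form_rpow hr hω hx hs).congr fun m => by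
      rw [norm_one, one_div, Real.rpow_neg (hpos m).le])
  have hterm : ∀ m : Fin r → ℕ,
      (((∑ k, ω k * x k) + ∑ j, (m j : ℝ) * ω j : ℝ) : ℂ) ^ (-s) = (Complex.Gamma s)⁻¹ *
        (Complex.Gamma s * 1 / (((∑ k, ω k * x k) + ∑ j, (m j : ℝ) * ω j : ℝ) : ℂ) ^ s) :=
    fun m => by
      rw [mul_one, Complex.cpow_neg, ← mul_div_assoc,
        inv_mul_cancel₀ (Complex.Gamma_ne_zero_of_re_pos hs0), one_div]
  simp only [hterm]
  exact h.mul_left _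

end barnesKernel

/-- the Barnes multiple zeta function
`ζ_r(s, ω, x) = ∑_{m ∈ ℕ^r} (x + m₁ω₁ + ⋯ + m_rω_r)^{-s}` with `x = ∑ ω_k x_k > 0`
extends to a function `Z` on `ℂ` that is analytic away from `{1, …, r}` (in particular
holomorphic at `s = 0`), agrees with the series for `Re s > r`, and satisfies Barnes'
special value formula
`Z 0 = (-1)^r ∑_{l₁+⋯+l_r = r} ω₁^{l₁-1} ⋯ ω_r^{l_r-1} ∏_k B_{l_k}(x_k) / l_k!`. -/
theorem barnes_zeta_value_at_zero (r : ℕ) (hr : 1 ≤ r) (ω x : Fin r → ℝ)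
    (hω : ∀ k, 0 < ω k) (hx : ∀ k, 0 ≤ x k) (hx0 : 0 < ∑ k, ω k * x k) :
    ∃ Z : ℂ → ℂ,
      (∀ s : ℂ, (r : ℝ) < s.re →
        HasSum (fun m : Fin r → ℕ =>
          (((∑ k, ω k * x k) + ∑ j, (m j : ℝ) * ω j : ℝ) : ℂ) ^ (-s)) (Z s)) ∧
      (∀ s : ℂ, (∀ t : ℕ, 1 ≤ t → t ≤ r → s ≠ (t : ℂ)) → AnalyticAt ℂ Z s) ∧
      AnalyticAt ℂ Z 0 ∧
      Z 0 = (-1) ^ r * ∑ l ∈ Finset.Nat.antidiagonalTuple r r,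
        (∏ k, ((ω k : ℂ) ^ ((l k : ℤ) - 1))) *
          ∏ k, (((Polynomial.aeval (x k) (Polynomial.bernoulli (l k)) : ℝ) : ℂ) /
            (Nat.factorial (l k) : ℂ)) := by
  obtain ⟨Z, h1, h2, h3⟩ := exists_analytic_mellin_div_Gamma
    ((continuousOn_barnesKernel (x := x) hω).locallyIntegrableOn measurableSet_Ioi)
    (barnesKernel_isBigO_atTop hω hx0) (barnesKernel_sub_isBigO hω)
  refine ⟨Z, fun s hs => ?_, h2, h2 0 fun t ht _ => ?_, ?_⟩
  · rw [h1 s hs]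
    exact hasSum_barnes_mellin hr hω hx0 hs
  · exact_mod_cast (Nat.one_le_iff_ne_zero.1 ht).symm
  · rw [h3, coeff_barnesSeries]
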